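/- Program subject reduction: if the program typing ε; ε ⊢ m : A is derivable in empty contexts and m program-reduces in one step to n, then ε; ε ⊢ n : A is derivable. -/

import Mathlib

namespace TLL

/-- The two sorts of TLL: `U` (non-linear) and `L` (linear). -/
inductive Srt : Type
  | U | L
deriving DecidableEq

/-- TLL terms in de Bruijn representation: variables, sorts, the two Π-type
formers (irrelevant `pi0` and relevant `pi1`), the two λ-formers, application,
the erased constant `box`, and heap pointers `ptr`. -/
inductive Tm : Type
  | var  : Nat → Tm
  | srt  : Srt → Tm
  | pi0  : Srt → Tm → Tm → Tm
  | pi1  : Srt → Tm → Tm → Tm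
  | lam0 : Srt → Tm → Tm → Tm
  | lam1 : Srt → Tm → Tm → Tm
  | app  : Tm → Tm → Tm
  | box  : Tm
  | ptr  : Nat → Tm

def upr (ξ : Nat → Nat) : Nat → Nat
  | 0 => 0
  | n + 1 => ξ n + 1

def rename (ξ : Nat → Nat) : Tm → Tm
  | .var x => .var (ξ x)
  | .srt s => .srt s
  | .pi0 t A B => .pi0 t (rename ξ A) (rename (upr ξ) B)
  | .pi1 t A B => .pi1 t (rename ξ A) (rename (upr ξ) B)
  | .lam0 t A m => .lam0 t (rename ξ A) (rename (upr ξ) m)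
  | .lam1 t A m => .lam1 t (rename ξ A) (rename (upr ξ) m)
  | .app m n => .app (rename ξ m) (rename ξ n)
  | .box => .box
  | .ptr l => .ptr l

def up (σ : Nat → Tm) : Nat → Tm
  | 0 => .var 0
  | n + 1 => rename Nat.succ (σ n)

def subst (σ : Nat → Tm) : Tm → Tm
  | .var x => σ x
  | .srt s => .srt s
  | .pi0 t A B => .pi0 t (subst σ A) (subst (up σ) B)
  | .pi1 t A B => .pi1 t (subst σ A) (subst (up σ) B)
  | .lam0 t A m => .lam0 t (subst σ A) (subst (up σ) m)
  | .lam1 t A m => .lam1 t (subst σ A) (subst (up σ) m)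
  | .app m n => .app (subst σ m) (subst σ n)
  | .box => .box
  | .ptr l => .ptr l

/-- `subst1 n m` is `m[n/x]` for the topmost bound variable `x`. -/
def subst1 (n : Tm) (m : Tm) : Tm :=
  subst (fun i => match i with | 0 => n | i + 1 => .var i) m

/-- Logical one-step reduction `m ~> n`: full β-reduction with both β-rules,
closed under all structural subterm positions. -/
inductive LStep : Tm → Tm → Prop
  | beta0 {t A m n} : LStep (.app (.lam0 t A m) n) (subst1 n m)
  | beta1 {t A m n} : LStep (.app (.lam1 t A m) n) (subst1 n m)
  | appL {m m' n} : LStep m m' → LStep (.app m n) (.app m' n)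
  | appR {m n n'} : LStep n n' → LStep (.app m n) (.app m n')
  | pi0A {t A A' B} : LStep A A' → LStep (.pi0 t A B) (.pi0 t A' B)
  | pi0B {t A B B'} : LStep B B' → LStep (.pi0 t A B) (.pi0 t A B')
  | pi1A {t A A' B} : LStep A A' → LStep (.pi1 t A B) (.pi1 t A' B)
  | pi1B {t A B B'} : LStep B B' → LStep (.pi1 t A B) (.pi1 t A B')
  | lam0A {t A A' m} : LStep A A' → LStep (.lam0 t A m) (.lam0 t A' m)
  | lam0M {t A m m'} : LStep m m' → LStep (.lam0 t A m) (.lam0 t A m')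
  | lam1A {t A A' m} : LStep A A' → LStep (.lam1 t A m) (.lam1 t A' m)
  | lam1M {t A m m'} : LStep m m' → LStep (.lam1 t A m) (.lam1 t A m')

/-- Multi-step logical reduction. -/
abbrev LRed : Tm → Tm → Prop := Relation.ReflTransGen LStep

/-- Definitional equality `A ≃ B`: equivalence closure of logical reduction. -/
def Conv (A B : Tm) : Prop := Relation.EqvGen LStep A B

/-- Parallel logical reduction `m ⇒ n`. -/
inductive PStep : Tm → Tm → Prop
  | var {x} : PStep (.var x) (.var x)
  | srt {s} : PStep (.srt s) (.srt s)
  | box : PStep .box .box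
  | ptr {l} : PStep (.ptr l) (.ptr l)
  | pi0 {t A A' B B'} : PStep A A' → PStep B B' → PStep (.pi0 t A B) (.pi0 t A' B')
  | pi1 {t A A' B B'} : PStep A A' → PStep B B' → PStep (.pi1 t A B) (.pi1 t A' B')
  | lam0 {t A A' m m'} : PStep A A' → PStep m m' → PStep (.lam0 t A m) (.lam0 t A' m')
  | lam1 {t A A' m m'} : PStep A A' → PStep m m' → PStep (.lam1 t A m) (.lam1 t A' m')
  | app {m m' n n'} : PStep m m' → PStep n n' → PStep (.app m n) (.app m' n')
  | beta0 {t A m m' n n'} : PStep m m' → PStep n n' →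
      PStep (.app (.lam0 t A m) n) (subst1 n' m')
  | beta1 {t A m m' n n'} : PStep m m' → PStep n n' →
      PStep (.app (.lam1 t A m) n) (subst1 n' m')

/-- Logical contexts: lists of types (de Bruijn). -/
abbrev Ctx := List Tm

/-- `Has Γ x A`: variable `x` has type `A` in logical context `Γ`
(with the appropriate de Bruijn shifts). -/
inductive Has : Ctx → Nat → Tm → Prop
  | zero {Γ A} : Has (A :: Γ) 0 (rename Nat.succ A)
  | succ {Γ x A B} : Has Γ x A → Has (B :: Γ) (x + 1) (rename Nat.succ A)

mutual
/-- Well-formed logical contexts. -/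
inductive LWf : Ctx → Prop
  | nil : LWf []
  | cons {Γ A s} : LWf Γ → LTyped Γ A (.srt s) → LWf (A :: Γ)

/-- The logical typing judgment `Γ ⊢ m : A`. -/
inductive LTyped : Ctx → Tm → Tm → Prop
  | srt {Γ} (s : Srt) : LWf Γ → LTyped Γ (.srt s) (.srt .U)
  | var {Γ x A} : LWf Γ → Has Γ x A → LTyped Γ (.var x) A
  | pi0 {Γ A B s r} (t : Srt) :
      LTyped Γ A (.srt s) → LTyped (A :: Γ) B (.srt r) →
      LTyped Γ (.pi0 t A B) (.srt t)
  | pi1 {Γ A B s r} (t : Srt) :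
      LTyped Γ A (.srt s) → LTyped (A :: Γ) B (.srt r) →
      LTyped Γ (.pi1 t A B) (.srt t)
  | lam0 {Γ A B m} (t : Srt) :
      LTyped (A :: Γ) m B → LTyped Γ (.lam0 t A m) (.pi0 t A B)
  | lam1 {Γ A B m} (t : Srt) :
      LTyped (A :: Γ) m B → LTyped Γ (.lam1 t A m) (.pi1 t A B)
  | app0 {Γ m n A B t} :
      LTyped Γ m (.pi0 t A B) → LTyped Γ n A → LTyped Γ (.app m n) (subst1 n B)
  | app1 {Γ m n A B t} :
      LTyped Γ m (.pi1 t A B) → LTyped Γ n A → LTyped Γ (.app m n) (subst1 n B)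
  | conv {Γ m A B s} :
      LTyped Γ m A → LTyped Γ B (.srt s) → Conv A B → LTyped Γ m B
end

/-- Program context entries: either absent, or a sort-annotated type. -/
abbrev Entry := Option (Srt × Tm)

/-- Program contexts, positionally aligned with the logical context. -/
abbrev PCtx := List Entry

/-- The context constraint `Δ ▷ s`. -/
inductive Restr : PCtx → Srt → Prop
  | nil {s} : Restr [] s
  | skip {Δ s} : Restr Δ s → Restr ((none : Entry) :: Δ) s
  | u {Δ A} : Restr Δ .U → Restr (some (.U, A) :: Δ) .U
  | l {Δ s A} : Restr Δ .L → Restr (some (s, A) :: Δ) .L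

/-- Context merge `Δ₁ ∪̇ Δ₂ = Δ`: contraction on shared `U` entries,
`L` entries occur on exactly one side. -/
inductive Merge : PCtx → PCtx → PCtx → Prop
  | nil : Merge [] [] []
  | contra {Δ₁ Δ₂ Δ A} : Merge Δ₁ Δ₂ Δ →
      Merge (some (.U, A) :: Δ₁) (some (.U, A) :: Δ₂) (some (.U, A) :: Δ)
  | left {Δ₁ Δ₂ Δ A} : Merge Δ₁ Δ₂ Δ →
      Merge (some (.L, A) :: Δ₁) ((none : Entry) :: Δ₂) (some (.L, A) :: Δ)
  | right {Δ₁ Δ₂ Δ A} : Merge Δ₁ Δ₂ Δ →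
      Merge ((none : Entry) :: Δ₁) (some (.L, A) :: Δ₂) (some (.L, A) :: Δ)
  | skip {Δ₁ Δ₂ Δ} : Merge Δ₁ Δ₂ Δ →
      Merge ((none : Entry) :: Δ₁) ((none : Entry) :: Δ₂) ((none : Entry) :: Δ)

/-- `PHas Δ x s A`: the entry `x :s A` occurs in `Δ` and the rest of `Δ`
satisfies `▷ U` (so no linear entry is discarded). -/
inductive PHas : PCtx → Nat → Srt → Tm → Prop
  | zero {Δ s A} : Restr Δ .U → PHas (some (s, A) :: Δ) 0 s (rename Nat.succ A)
  | succN {Δ x s A} : PHas Δ x s A → PHas ((none : Entry) :: Δ) (x + 1) s (rename Nat.succ A)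
  | succU {Δ x s A B} : PHas Δ x s A → PHas (some (.U, B) :: Δ) (x + 1) s (rename Nat.succ A)

/-- Well-formed pairs of logical and program contexts `Γ ; Δ ⊢`. -/
inductive PWf : Ctx → PCtx → Prop
  | nil : PWf [] []
  | cons {Γ Δ A s} : PWf Γ Δ → LTyped Γ A (.srt s) → PWf (A :: Γ) (some (s, A) :: Δ)
  | consN {Γ Δ A s} : PWf Γ Δ → LTyped Γ A (.srt s) → PWf (A :: Γ) ((none : Entry) :: Δ)

/-- The program typing judgment `Γ ; Δ ⊢ m : A`. -/
inductive PTyped : Ctx → PCtx → Tm → Tm → Prop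
  | var {Γ Δ x s A} : PWf Γ Δ → PHas Δ x s A → PTyped Γ Δ (.var x) A
  | lam0 {Γ Δ A B m} (t : Srt) :
      PTyped (A :: Γ) ((none : Entry) :: Δ) m B → Restr Δ t →
      PTyped Γ Δ (.lam0 t A m) (.pi0 t A B)
  | lam1 {Γ Δ A B m s} (t : Srt) :
      PTyped (A :: Γ) (some (s, A) :: Δ) m B → Restr Δ t →
      PTyped Γ Δ (.lam1 t A m) (.pi1 t A B)
  | app0 {Γ Δ m n A B t} :
      PTyped Γ Δ m (.pi0 t A B) → LTyped Γ n A →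
      PTyped Γ Δ (.app m n) (subst1 n B)
  | app1 {Γ Δ₁ Δ₂ Δ m n A B t} :
      PTyped Γ Δ₁ m (.pi1 t A B) → PTyped Γ Δ₂ n A → Merge Δ₁ Δ₂ Δ →
      PTyped Γ Δ (.app m n) (subst1 n B)
  | conv {Γ Δ m A B s} :
      PTyped Γ Δ m A → LTyped Γ B (.srt s) → Conv A B →
      PTyped Γ Δ m B

/-- Program values. -/
inductive Value : Tm → Prop
  | var {x} : Value (.var x)
  | lam0 {t A m} : Value (.lam0 t A m)
  | lam1 {t A m} : Value (.lam1 t A m)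

/-- Program (call-by-value) one-step reduction `m ~~> n`. -/
inductive CStep : Tm → Tm → Prop
  | appL {m m' n} : CStep m m' → CStep (.app m n) (.app m' n)
  | appR {m n n'} : CStep n n' → CStep (.app m n) (.app m n')
  | beta0 {t A m n} : CStep (.app (.lam0 t A m) n) (subst1 n m)
  | beta1 {t A m v} : Value v → CStep (.app (.lam1 t A m) v) (subst1 v m)

/-- The erasure judgment `Γ ; Δ ⊢ m ~ m' : A`. -/
inductive Erase : Ctx → PCtx → Tm → Tm → Tm → Prop
  | var {Γ Δ x s A} : PWf Γ Δ → PHas Δ x s A → Erase Γ Δ (.var x) (.var x) A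
  | lam0 {Γ Δ A B m m'} (t : Srt) :
      Erase (A :: Γ) ((none : Entry) :: Δ) m m' B → Restr Δ t →
      Erase Γ Δ (.lam0 t A m) (.lam0 t .box m') (.pi0 t A B)
  | lam1 {Γ Δ A B m m' s} (t : Srt) :
      Erase (A :: Γ) (some (s, A) :: Δ) m m' B → Restr Δ t →
      Erase Γ Δ (.lam1 t A m) (.lam1 t .box m') (.pi1 t A B)
  | app0 {Γ Δ m m' n A B t} :
      Erase Γ Δ m m' (.pi0 t A B) → LTyped Γ n A →
      Erase Γ Δ (.app m n) (.app m' .box) (subst1 n B)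
  | app1 {Γ Δ₁ Δ₂ Δ m m' n n' A B t} :
      Erase Γ Δ₁ m m' (.pi1 t A B) → Erase Γ Δ₂ n n' A → Merge Δ₁ Δ₂ Δ →
      Erase Γ Δ (.app m n) (.app m' n') (subst1 n B)
  | conv {Γ Δ m m' A B s} :
      Erase Γ Δ m m' A → LTyped Γ B (.srt s) → Conv A B →
      Erase Γ Δ m m' B

/-- Heaps: finite maps from locations to sort-annotated values. -/
abbrev Heap := Nat → Option (Srt × Tm)

/-- Heap lookup `Lookup H₁ l v H₂`: non-linear cells persist, linear cells
are deallocated. -/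
inductive Lookup : Heap → Nat → Tm → Heap → Prop
  | u {H l v} : H l = some (.U, v) → Lookup H l v H
  | l {H l v} : H l = some (.L, v) → Lookup H l v (Function.update H l none)

/-- Heap merge `H₁ ∪̇ H₂ = H`. -/
def HMerge (H₁ H₂ H : Heap) : Prop := ∀ l,
  (H₁ l = none ∧ H₂ l = none ∧ H l = none) ∨
  (∃ v, H₁ l = some (.U, v) ∧ H₂ l = some (.U, v) ∧ H l = some (.U, v)) ∨
  (∃ v, H₁ l = some (.L, v) ∧ H₂ l = none ∧ H l = some (.L, v)) ∨
  (∃ v, H₁ l = none ∧ H₂ l = some (.L, v) ∧ H l = some (.L, v))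

/-- The heap constraint `H ▷ s`. -/
def HRestr (H : Heap) : Srt → Prop
  | .U => ∀ l s v, H l = some (s, v) → s = Srt.U
  | .L => True

/-- Heap reduction `H ; m ~~> H' ; m'`. -/
inductive HStep : Heap → Tm → Heap → Tm → Prop
  | alloc0 {H l t m} : H l = none →
      HStep H (.lam0 t .box m) (Function.update H l (some (t, .lam0 t .box m))) (.ptr l)
  | alloc1 {H l t m} : H l = none →
      HStep H (.lam1 t .box m) (Function.update H l (some (t, .lam1 t .box m))) (.ptr l)
  | appL {H H' m m' n} : HStep H m H' m' → HStep H (.app m n) H' (.app m' n)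
  | appR {H H' m n n'} : HStep H n H' n' → HStep H (.app m n) H' (.app m n')
  | beta0 {H H' l t m n} : Lookup H l (.lam0 t .box m) H' →
      HStep H (.app (.ptr l) n) H' (subst1 .box m)
  | beta1 {H H' l₁ l₂ t m} : Lookup H l₁ (.lam1 t .box m) H' →
      HStep H (.app (.ptr l₁) (.ptr l₂)) H' (subst1 (.ptr l₂) m)

/-- Pointer resolution `H ; m ~ n`. -/
inductive Resolve : Heap → Tm → Tm → Prop
  | var {H x} : HRestr H .U → Resolve H (.var x) (.var x)
  | lam0 {H t m' m} : HRestr H t → Resolve H m' m →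
      Resolve H (.lam0 t .box m') (.lam0 t .box m)
  | lam1 {H t m' m} : HRestr H t → Resolve H m' m →
      Resolve H (.lam1 t .box m') (.lam1 t .box m)
  | app0 {H m' m} : Resolve H m' m → Resolve H (.app m' .box) (.app m .box)
  | app1 {H₁ H₂ H m' m n' n} : HMerge H₁ H₂ H →
      Resolve H₁ m' m → Resolve H₂ n' n → Resolve H (.app m' n') (.app m n)
  | ptr {H H' l v' v} : Lookup H l v' H' → Resolve H' v' v → Resolve H (.ptr l) v

/-- `ClosedUnder k m`: all free de Bruijn variables of `m` are `< k`. -/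
def ClosedUnder : Nat → Tm → Prop
  | k, .var x => x < k
  | _, .srt _ => True
  | k, .pi0 _ A B => ClosedUnder k A ∧ ClosedUnder (k + 1) B
  | k, .pi1 _ A B => ClosedUnder k A ∧ ClosedUnder (k + 1) B
  | k, .lam0 _ A m => ClosedUnder k A ∧ ClosedUnder (k + 1) m
  | k, .lam1 _ A m => ClosedUnder k A ∧ ClosedUnder (k + 1) m
  | k, .app m n => ClosedUnder k m ∧ ClosedUnder k n
  | _, .box => True
  | _, .ptr _ => True

/-- WR-heaps: heaps plausibly produced by heap reduction. -/
inductive WrHeap : Heap → Prop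
  | nil : WrHeap (fun _ => none)
  | lam0 {H l t m} : ClosedUnder 1 m → WrHeap H → H l = none →
      WrHeap (Function.update H l (some (t, .lam0 t .box m)))
  | lam1 {H l t m} : ClosedUnder 1 m → WrHeap H → H l = none →
      WrHeap (Function.update H l (some (t, .lam1 t .box m)))

/-- Well-resolved `H ⊢ a ~ b ~ c : A`. -/
def WellResolved (H : Heap) (a b c A : Tm) : Prop :=
  Erase [] [] a b A ∧ Resolve H c b

/-! ### Renaming and substitution -/

theorem rename_eq_subst (ξ : Nat → Nat) (m : Tm) :
    rename ξ m = subst (fun x => .var (ξ x)) m := by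
  have key : ∀ ξ : Nat → Nat, (fun x => Tm.var (upr ξ x)) = up (fun x => .var (ξ x)) := by
    intro ξ
    funext x
    cases x <;> rfl
  induction m generalizing ξ <;> simp_all [rename, subst]

theorem subst_rename (σ : Nat → Tm) (ξ : Nat → Nat) (m : Tm) :
    subst σ (rename ξ m) = subst (fun x => σ (ξ x)) m := by
  have key : ∀ (σ : Nat → Tm) (ξ : Nat → Nat),
      (fun x => up σ (upr ξ x)) = up (fun x => σ (ξ x)) := by
    intro σ ξ
    funext x
    cases x <;> rfl
  induction m generalizing σ ξ <;> simp_all [rename, subst]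

theorem rename_rename (ζ ξ : Nat → Nat) (m : Tm) :
    rename ζ (rename ξ m) = rename (fun x => ζ (ξ x)) m := by
  rw [rename_eq_subst ζ, subst_rename, rename_eq_subst]

theorem rename_upr_shift (ξ : Nat → Nat) (m : Tm) :
    rename (upr ξ) (rename Nat.succ m) = rename Nat.succ (rename ξ m) := by
  rw [rename_rename, rename_rename]
  rfl

theorem rename_subst (ξ : Nat → Nat) (σ : Nat → Tm) (m : Tm) :
    rename ξ (subst σ m) = subst (fun x => rename ξ (σ x)) m := by
  have key : ∀ (ξ : Nat → Nat) (σ : Nat → Tm),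
      (fun x => rename (upr ξ) (up σ x)) = up (fun x => rename ξ (σ x)) := by
    intro ξ σ
    funext x
    cases x with
    | zero => rfl
    | succ x => exact rename_upr_shift ξ (σ x)
  induction m generalizing ξ σ <;> simp_all [rename, subst]

theorem subst_up_shift (σ : Nat → Tm) (m : Tm) :
    subst (up σ) (rename Nat.succ m) = rename Nat.succ (subst σ m) := by
  rw [subst_rename, rename_subst]
  rfl

theorem subst_subst (τ σ : Nat → Tm) (m : Tm) :
    subst τ (subst σ m) = subst (fun x => subst τ (σ x)) m := by
  have key : ∀ τ σ : Nat → Tm,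
      (fun x => subst (up τ) (up σ x)) = up (fun x => subst τ (σ x)) := by
    intro τ σ
    funext x
    cases x with
    | zero => rfl
    | succ x => exact subst_up_shift τ (σ x)
  induction m generalizing τ σ <;> simp_all [subst]

theorem subst_var (m : Tm) : subst .var m = m := by
  have key : up .var = .var := by
    funext x
    cases x <;> rfl
  induction m <;> simp_all [subst]

/-- The substitution sending the topmost variable to `n` and lowering the others. -/
def single (n : Tm) : Nat → Tm
  | 0 => n
  | i + 1 => .var i

theorem subst1_eq (n m : Tm) : subst1 n m = subst (single n) m := rfl

theorem subst_single_shift (n m : Tm) : subst (single n) (rename Nat.succ m) = m := by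
  rw [subst_rename]
  exact subst_var m

theorem subst_subst1 (σ : Nat → Tm) (n m : Tm) :
    subst σ (subst1 n m) = subst1 (subst σ n) (subst (up σ) m) := by
  rw [subst1_eq, subst1_eq, subst_subst, subst_subst]
  congr 1
  funext x
  cases x with
  | zero => rfl
  | succ x => exact (subst_single_shift (subst σ n) (σ x)).symm

theorem rename_subst1 (ξ : Nat → Nat) (n m : Tm) :
    rename ξ (subst1 n m) = subst1 (rename ξ n) (rename (upr ξ) m) := by
  rw [subst1_eq, subst1_eq, subst_rename, rename_subst]
  congr 1
  funext x
  cases x <;> rfl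

/-! ### Reduction and substitution -/

theorem LStep.subst {m n : Tm} (h : LStep m n) (σ : Nat → Tm) :
    LStep (subst σ m) (subst σ n) := by
  induction h generalizing σ with
  | beta0 => rw [subst_subst1]; exact .beta0
  | beta1 => rw [subst_subst1]; exact .beta1
  | appL _ ih => exact .appL (ih σ)
  | appR _ ih => exact .appR (ih σ)
  | pi0A _ ih => exact .pi0A (ih σ)
  | pi0B _ ih => exact .pi0B (ih (up σ))
  | pi1A _ ih => exact .pi1A (ih σ)
  | pi1B _ ih => exact .pi1B (ih (up σ))
  | lam0A _ ih => exact .lam0A (ih σ)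
  | lam0M _ ih => exact .lam0M (ih (up σ))
  | lam1A _ ih => exact .lam1A (ih σ)
  | lam1M _ ih => exact .lam1M (ih (up σ))

theorem Conv.refl (A : Tm) : Conv A A := Relation.EqvGen.refl A

theorem Conv.symm {A B : Tm} (h : Conv A B) : Conv B A := Relation.EqvGen.symm _ _ h

theorem Conv.trans {A B C : Tm} (h : Conv A B) (h' : Conv B C) : Conv A C :=
  Relation.EqvGen.trans _ _ _ h h'

theorem Conv.map {f : Tm → Tm} (hf : ∀ {a b}, LStep a b → LStep (f a) (f b)) {A B : Tm}
    (h : Conv A B) : Conv (f A) (f B) := by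
  induction h with
  | rel _ _ h => exact .rel _ _ (hf h)
  | refl => exact .refl _
  | symm _ _ _ ih => exact ih.symm
  | trans _ _ _ _ _ ih₁ ih₂ => exact ih₁.trans ih₂

theorem Conv.subst {A B : Tm} (h : Conv A B) (σ : Nat → Tm) :
    Conv (subst σ A) (subst σ B) :=
  h.map fun h => h.subst σ

theorem Conv.rename {A B : Tm} (h : Conv A B) (ξ : Nat → Nat) :
    Conv (rename ξ A) (rename ξ B) := by
  rw [rename_eq_subst, rename_eq_subst]
  exact h.subst _

theorem Conv.subst1 {A B : Tm} (h : Conv A B) (n : Tm) :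
    Conv (subst1 n A) (subst1 n B) :=
  h.subst _

/-! ### Parallel reduction and confluence -/

theorem PStep.refl (m : Tm) : PStep m m := by
  induction m <;> constructor <;> assumption

theorem PStep.subst {m n : Tm} (h : PStep m n) {σ τ : Nat → Tm}
    (hσ : ∀ x, PStep (σ x) (τ x)) : PStep (subst σ m) (subst τ n) := by
  have shift : ∀ {m n : Tm}, PStep m n → ∀ ξ, PStep (rename ξ m) (rename ξ n) := by
    intro m n h
    induction h with
    | var => exact fun _ => .var
    | srt => exact fun _ => .srt
    | box => exact fun _ => .box
    | ptr => exact fun _ => .ptr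
    | pi0 _ _ ih₁ ih₂ => exact fun ξ => .pi0 (ih₁ ξ) (ih₂ _)
    | pi1 _ _ ih₁ ih₂ => exact fun ξ => .pi1 (ih₁ ξ) (ih₂ _)
    | lam0 _ _ ih₁ ih₂ => exact fun ξ => .lam0 (ih₁ ξ) (ih₂ _)
    | lam1 _ _ ih₁ ih₂ => exact fun ξ => .lam1 (ih₁ ξ) (ih₂ _)
    | app _ _ ih₁ ih₂ => exact fun ξ => .app (ih₁ ξ) (ih₂ ξ)
    | beta0 _ _ ih₁ ih₂ => intro ξ; rw [rename_subst1]; exact .beta0 (ih₁ _) (ih₂ ξ)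
    | beta1 _ _ ih₁ ih₂ => intro ξ; rw [rename_subst1]; exact .beta1 (ih₁ _) (ih₂ ξ)
  have lift : ∀ {σ τ : Nat → Tm}, (∀ x, PStep (σ x) (τ x)) → ∀ x, PStep (up σ x) (up τ x) := by
    intro σ τ hσ x
    cases x with
    | zero => exact .var
    | succ x => exact shift (hσ x) _
  induction h generalizing σ τ with
  | var => exact hσ _
  | srt => exact .srt
  | box => exact .box
  | ptr => exact .ptr
  | pi0 _ _ ih₁ ih₂ => exact .pi0 (ih₁ hσ) (ih₂ (lift hσ))
  | pi1 _ _ ih₁ ih₂ => exact .pi1 (ih₁ hσ) (ih₂ (lift hσ))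
  | lam0 _ _ ih₁ ih₂ => exact .lam0 (ih₁ hσ) (ih₂ (lift hσ))
  | lam1 _ _ ih₁ ih₂ => exact .lam1 (ih₁ hσ) (ih₂ (lift hσ))
  | app _ _ ih₁ ih₂ => exact .app (ih₁ hσ) (ih₂ hσ)
  | beta0 _ _ ih₁ ih₂ => rw [subst_subst1]; exact .beta0 (ih₁ (lift hσ)) (ih₂ hσ)
  | beta1 _ _ ih₁ ih₂ => rw [subst_subst1]; exact .beta1 (ih₁ (lift hσ)) (ih₂ hσ)

theorem PStep.subst1 {m m' n n' : Tm} (hm : PStep m m') (hn : PStep n n') :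
    PStep (subst1 n m) (subst1 n' m') := by
  rw [subst1_eq, subst1_eq]
  refine hm.subst fun x => ?_
  cases x with
  | zero => exact hn
  | succ x => exact .var

theorem LStep.pstep {m n : Tm} (h : LStep m n) : PStep m n := by
  induction h with
  | beta0 => exact .beta0 (.refl _) (.refl _)
  | beta1 => exact .beta1 (.refl _) (.refl _)
  | appL _ ih => exact .app ih (.refl _)
  | appR _ ih => exact .app (.refl _) ih
  | pi0A _ ih => exact .pi0 ih (.refl _)
  | pi0B _ ih => exact .pi0 (.refl _) ih
  | pi1A _ ih => exact .pi1 ih (.refl _)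
  | pi1B _ ih => exact .pi1 (.refl _) ih
  | lam0A _ ih => exact .lam0 ih (.refl _)
  | lam0M _ ih => exact .lam0 (.refl _) ih
  | lam1A _ ih => exact .lam1 ih (.refl _)
  | lam1M _ ih => exact .lam1 (.refl _) ih

theorem PStep.conv {m n : Tm} (h : PStep m n) : Conv m n := by
  induction h with
  | var | srt | box | ptr => exact .refl _
  | pi0 _ _ ih₁ ih₂ => exact (ih₁.map LStep.pi0A).trans (ih₂.map LStep.pi0B)
  | pi1 _ _ ih₁ ih₂ => exact (ih₁.map LStep.pi1A).trans (ih₂.map LStep.pi1B)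
  | lam0 _ _ ih₁ ih₂ => exact (ih₁.map LStep.lam0A).trans (ih₂.map LStep.lam0M)
  | lam1 _ _ ih₁ ih₂ => exact (ih₁.map LStep.lam1A).trans (ih₂.map LStep.lam1M)
  | app _ _ ih₁ ih₂ =>
    exact (ih₁.map (f := fun m => .app m _) LStep.appL).trans (ih₂.map LStep.appR)
  | @beta0 t A _ m' _ _ _ _ ih₁ ih₂ =>
    exact ((ih₁.map (f := fun m => .app (.lam0 t A m) _) fun h => .appL (.lam0M h)).trans
      (ih₂.map LStep.appR)).trans (.rel _ _ .beta0)
  | @beta1 t A _ m' _ _ _ _ ih₁ ih₂ =>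
    exact ((ih₁.map (f := fun m => .app (.lam1 t A m) _) fun h => .appL (.lam1M h)).trans
      (ih₂.map LStep.appR)).trans (.rel _ _ .beta1)

/-- The complete development of a term: all its redexes are contracted at once. -/
def develop : Tm → Tm
  | .var x => .var x
  | .srt s => .srt s
  | .pi0 t A B => .pi0 t (develop A) (develop B)
  | .pi1 t A B => .pi1 t (develop A) (develop B)
  | .lam0 t A m => .lam0 t (develop A) (develop m)
  | .lam1 t A m => .lam1 t (develop A) (develop m)
  | .app (.lam0 _ _ m) n => subst1 (develop n) (develop m)
  | .app (.lam1 _ _ m) n => subst1 (develop n) (develop m)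
  | .app m n => .app (develop m) (develop n)
  | .box => .box
  | .ptr l => .ptr l

theorem PStep.develop {m n : Tm} (h : PStep m n) : PStep n (develop m) := by
  induction h with
  | var => exact .var
  | srt => exact .srt
  | box => exact .box
  | ptr => exact .ptr
  | pi0 _ _ ih₁ ih₂ => exact .pi0 ih₁ ih₂
  | pi1 _ _ ih₁ ih₂ => exact .pi1 ih₁ ih₂
  | lam0 _ _ ih₁ ih₂ => exact .lam0 ih₁ ih₂
  | lam1 _ _ ih₁ ih₂ => exact .lam1 ih₁ ih₂
  | @app m _ _ _ h _ ih₁ ih₂ =>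
    cases m with
    | lam0 =>
      cases h
      cases ih₁ with
      | lam0 _ hm => exact .beta0 hm ih₂
    | lam1 =>
      cases h
      cases ih₁ with
      | lam1 _ hm => exact .beta1 hm ih₂
    | _ => exact .app ih₁ ih₂
  | beta0 _ _ ih₁ ih₂ => exact ih₁.subst1 ih₂
  | beta1 _ _ ih₁ ih₂ => exact ih₁.subst1 ih₂

/-- Multi-step parallel reduction. -/
abbrev PRed : Tm → Tm → Prop := Relation.ReflTransGen PStep

theorem PRed.conv {A B : Tm} (h : PRed A B) : Conv A B := by
  induction h with
  | refl => exact .refl _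
  | tail _ h ih => exact ih.trans h.conv

theorem PRed.church_rosser {a b c : Tm} (hb : PRed a b) (hc : PRed a c) :
    ∃ d, PRed b d ∧ PRed c d :=
  Relation.church_rosser
    (fun a _ _ hb hc => ⟨develop a, .single hb.develop, .single hc.develop⟩) hb hc

theorem Conv.join {A B : Tm} (h : Conv A B) : ∃ C, PRed A C ∧ PRed B C := by
  induction h with
  | rel _ B h => exact ⟨B, .single h.pstep, .refl⟩
  | refl A => exact ⟨A, .refl, .refl⟩
  | symm _ _ _ ih => exact ih.imp fun _ h => h.symm
  | trans _ _ _ _ _ ih₁ ih₂ =>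
    obtain ⟨C, h₁, h₂⟩ := ih₁
    obtain ⟨D, h₃, h₄⟩ := ih₂
    obtain ⟨E, h₅, h₆⟩ := h₂.church_rosser h₃
    exact ⟨E, h₁.trans h₅, h₄.trans h₆⟩

theorem PRed.pi0_inv {t A B C} (h : PRed (.pi0 t A B) C) :
    ∃ A' B', C = .pi0 t A' B' ∧ PRed A A' ∧ PRed B B' := by
  induction h with
  | refl => exact ⟨A, B, rfl, .refl, .refl⟩
  | tail _ h ih =>
    obtain ⟨A', B', rfl, hA, hB⟩ := ih
    cases h with
    | pi0 hA' hB' => exact ⟨_, _, rfl, hA.tail hA', hB.tail hB'⟩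

theorem PRed.pi1_inv {t A B C} (h : PRed (.pi1 t A B) C) :
    ∃ A' B', C = .pi1 t A' B' ∧ PRed A A' ∧ PRed B B' := by
  induction h with
  | refl => exact ⟨A, B, rfl, .refl, .refl⟩
  | tail _ h ih =>
    obtain ⟨A', B', rfl, hA, hB⟩ := ih
    cases h with
    | pi1 hA' hB' => exact ⟨_, _, rfl, hA.tail hA', hB.tail hB'⟩

theorem Conv.pi0_inj {t A B t' A' B'} (h : Conv (.pi0 t A B) (.pi0 t' A' B')) :
    Conv A A' ∧ Conv B B' := by
  obtain ⟨C, h₁, h₂⟩ := h.join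
  obtain ⟨A₁, B₁, rfl, hA₁, hB₁⟩ := h₁.pi0_inv
  obtain ⟨A₂, B₂, e, hA₂, hB₂⟩ := h₂.pi0_inv
  cases e
  exact ⟨hA₁.conv.trans hA₂.conv.symm, hB₁.conv.trans hB₂.conv.symm⟩

theorem Conv.pi1_inj {t A B t' A' B'} (h : Conv (.pi1 t A B) (.pi1 t' A' B')) :
    Conv A A' ∧ Conv B B' := by
  obtain ⟨C, h₁, h₂⟩ := h.join
  obtain ⟨A₁, B₁, rfl, hA₁, hB₁⟩ := h₁.pi1_inv
  obtain ⟨A₂, B₂, e, hA₂, hB₂⟩ := h₂.pi1_inv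
  cases e
  exact ⟨hA₁.conv.trans hA₂.conv.symm, hB₁.conv.trans hB₂.conv.symm⟩

theorem Conv.not_pi0_pi1 {t A B t' A' B'} : ¬ Conv (.pi0 t A B) (.pi1 t' A' B') := by
  intro h
  obtain ⟨C, h₁, h₂⟩ := h.join
  obtain ⟨A₁, B₁, rfl, -, -⟩ := h₁.pi0_inv
  obtain ⟨A₂, B₂, e, -, -⟩ := h₂.pi1_inv
  cases e

theorem CStep.lstep {m n : Tm} (h : CStep m n) : LStep m n := by
  induction h with
  | appL _ ih => exact .appL ih
  | appR _ ih => exact .appR ih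
  | beta0 => exact .beta0
  | beta1 => exact .beta1

theorem CStep.conv_subst1 {n n' : Tm} (h : CStep n n') (B : Tm) :
    Conv (subst1 n B) (subst1 n' B) :=
  ((PStep.refl B).subst1 h.lstep.pstep).conv

/-! ### Logical typing -/

/-- Every entry of the context satisfies `P` relative to the entries below it. -/
def AllEntries (P : Ctx → Tm → Prop) : Ctx → Prop
  | [] => True
  | A :: Γ => AllEntries P Γ ∧ P Γ A

/-- Induction on logical typing in which the λ-cases also provide the typing of the domain,
together with its induction hypothesis. -/
theorem LTyped.domain_induction {P : ∀ {Γ m A}, LTyped Γ m A → Prop}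
    (srt : ∀ {Γ} s (hΓ : LWf Γ), P (.srt s hΓ))
    (var : ∀ {Γ x A} (hΓ : LWf Γ) (hx : Has Γ x A), P (.var hΓ hx))
    (pi0 : ∀ {Γ A B s r} t (hA : LTyped Γ A (.srt s)) (hB : LTyped (A :: Γ) B (.srt r)),
      P hA → P hB → P (.pi0 t hA hB))
    (pi1 : ∀ {Γ A B s r} t (hA : LTyped Γ A (.srt s)) (hB : LTyped (A :: Γ) B (.srt r)),
      P hA → P hB → P (.pi1 t hA hB))
    (lam0 : ∀ {Γ A B m s} t (hA : LTyped Γ A (.srt s)) (hm : LTyped (A :: Γ) m B),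
      P hA → P hm → P (.lam0 t hm))
    (lam1 : ∀ {Γ A B m s} t (hA : LTyped Γ A (.srt s)) (hm : LTyped (A :: Γ) m B),
      P hA → P hm → P (.lam1 t hm))
    (app0 : ∀ {Γ m n A B t} (hm : LTyped Γ m (.pi0 t A B)) (hn : LTyped Γ n A),
      P hm → P hn → P (.app0 hm hn))
    (app1 : ∀ {Γ m n A B t} (hm : LTyped Γ m (.pi1 t A B)) (hn : LTyped Γ n A),
      P hm → P hn → P (.app1 hm hn))
    (conv : ∀ {Γ m A B s} (hm : LTyped Γ m A) (hB : LTyped Γ B (.srt s)) (hc : Conv A B),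
      P hm → P hB → P (.conv hm hB hc))
    {Γ m A} (h : LTyped Γ m A) : P h := by
  let Q : Ctx → Prop := AllEntries fun Γ A => ∃ s, ∃ h : LTyped Γ A (.srt s), P h
  refine (LTyped.rec (motive_1 := fun Γ _ => Q Γ) (motive_2 := fun Γ _ _ h => Q Γ ∧ P h)
    ?_ ?_ ?_ ?_ ?_ ?_ ?_ ?_ ?_ ?_ ?_ h).2
  · trivial
  · exact fun _ h ihΓ ih => ⟨ihΓ, _, h, ih.2⟩
  · exact fun s h ih => ⟨ih, srt s h⟩
  · exact fun h hx ih => ⟨ih, var h hx⟩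
  · exact fun t h₁ h₂ ih₁ ih₂ => ⟨ih₁.1, pi0 t h₁ h₂ ih₁.2 ih₂.2⟩
  · exact fun t h₁ h₂ ih₁ ih₂ => ⟨ih₁.1, pi1 t h₁ h₂ ih₁.2 ih₂.2⟩
  · rintro _ _ _ _ t h ⟨⟨ihΓ, s, hA, ihA⟩, ih⟩
    exact ⟨ihΓ, lam0 t hA h ihA ih⟩
  · rintro _ _ _ _ t h ⟨⟨ihΓ, s, hA, ihA⟩, ih⟩
    exact ⟨ihΓ, lam1 t hA h ihA ih⟩
  · exact fun h₁ h₂ ih₁ ih₂ => ⟨ih₁.1, app0 h₁ h₂ ih₁.2 ih₂.2⟩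
  · exact fun h₁ h₂ ih₁ ih₂ => ⟨ih₁.1, app1 h₁ h₂ ih₁.2 ih₂.2⟩
  · exact fun h₁ h₂ hc ih₁ ih₂ => ⟨ih₁.1, conv h₁ h₂ hc ih₁.2 ih₂.2⟩

theorem LTyped.wf {Γ m A} (h : LTyped Γ m A) : LWf Γ := by
  induction h using LTyped.domain_induction with
  | srt _ h | var h _ => exact h
  | pi0 _ _ _ ih _ | pi1 _ _ _ ih _ | lam0 _ _ _ ih _ | lam1 _ _ _ ih _
  | app0 _ _ ih _ | app1 _ _ ih _ | conv _ _ _ ih _ => exact ih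

theorem LTyped.rename {Γ m A} (h : LTyped Γ m A) :
    ∀ {ξ Γ'}, LWf Γ' → (∀ {x A}, Has Γ x A → Has Γ' (ξ x) (rename ξ A)) →
      LTyped Γ' (rename ξ m) (rename ξ A) := by
  have lift : ∀ {ξ : Nat → Nat} {Γ Γ' A},
      (∀ {x B}, Has Γ x B → Has Γ' (ξ x) (TLL.rename ξ B)) →
      ∀ {x B}, Has (A :: Γ) x B →
        Has (TLL.rename ξ A :: Γ') (upr ξ x) (TLL.rename (upr ξ) B) := by
    intro ξ Γ Γ' A hξ x B h
    cases h with
    | zero => rw [rename_upr_shift]; exact .zero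
    | succ h => rw [rename_upr_shift]; exact .succ (hξ h)
  induction h using LTyped.domain_induction with
  | srt s _ => exact fun hΓ _ => .srt s hΓ
  | var _ hx => exact fun hΓ hξ => .var hΓ (hξ hx)
  | pi0 t _ _ ih₁ ih₂ =>
    exact fun hΓ hξ => .pi0 t (ih₁ hΓ hξ) (ih₂ (.cons hΓ (ih₁ hΓ hξ)) (lift hξ))
  | pi1 t _ _ ih₁ ih₂ =>
    exact fun hΓ hξ => .pi1 t (ih₁ hΓ hξ) (ih₂ (.cons hΓ (ih₁ hΓ hξ)) (lift hξ))
  | lam0 t _ _ ih₁ ih₂ =>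
    exact fun hΓ hξ => .lam0 t (ih₂ (.cons hΓ (ih₁ hΓ hξ)) (lift hξ))
  | lam1 t _ _ ih₁ ih₂ =>
    exact fun hΓ hξ => .lam1 t (ih₂ (.cons hΓ (ih₁ hΓ hξ)) (lift hξ))
  | app0 _ _ ih₁ ih₂ =>
    intro ξ Γ' hΓ hξ
    rw [rename_subst1]
    exact .app0 (ih₁ hΓ hξ) (ih₂ hΓ hξ)
  | app1 _ _ ih₁ ih₂ =>
    intro ξ Γ' hΓ hξ
    rw [rename_subst1]
    exact .app1 (ih₁ hΓ hξ) (ih₂ hΓ hξ)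
  | conv _ _ hc ih₁ ih₂ =>
    exact fun hΓ hξ => .conv (ih₁ hΓ hξ) (ih₂ hΓ hξ) (hc.rename _)

theorem LTyped.shift {Γ m A B s} (h : LTyped Γ m A) (hB : LTyped Γ B (.srt s)) :
    LTyped (B :: Γ) (TLL.rename Nat.succ m) (TLL.rename Nat.succ A) :=
  h.rename (.cons h.wf hB) .succ

/-- `σ` sends the variables of `Γ` to terms typed in `Γ'`. -/
def LSubst (σ : Nat → Tm) (Γ Γ' : Ctx) : Prop :=
  ∀ {x A}, Has Γ x A → LTyped Γ' (σ x) (subst σ A)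

theorem LSubst.up {σ Γ Γ' A s} (h : LSubst σ Γ Γ') (hA : LTyped Γ' (subst σ A) (.srt s)) :
    LSubst (up σ) (A :: Γ) (subst σ A :: Γ') := by
  intro x B hx
  cases hx with
  | zero => rw [subst_up_shift]; exact .var (.cons hA.wf hA) .zero
  | succ hx => rw [subst_up_shift]; exact (h hx).shift hA

theorem LTyped.subst {Γ m A} (h : LTyped Γ m A) :
    ∀ {σ Γ'}, LWf Γ' → LSubst σ Γ Γ' → LTyped Γ' (subst σ m) (subst σ A) := by
  induction h using LTyped.domain_induction with
  | srt s _ => exact fun hΓ _ => .srt s hΓ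
  | var _ hx => exact fun _ hσ => hσ hx
  | pi0 t _ _ ih₁ ih₂ =>
    exact fun hΓ hσ => .pi0 t (ih₁ hΓ hσ) (ih₂ (.cons hΓ (ih₁ hΓ hσ)) (hσ.up (ih₁ hΓ hσ)))
  | pi1 t _ _ ih₁ ih₂ =>
    exact fun hΓ hσ => .pi1 t (ih₁ hΓ hσ) (ih₂ (.cons hΓ (ih₁ hΓ hσ)) (hσ.up (ih₁ hΓ hσ)))
  | lam0 t _ _ ih₁ ih₂ =>
    exact fun hΓ hσ => .lam0 t (ih₂ (.cons hΓ (ih₁ hΓ hσ)) (hσ.up (ih₁ hΓ hσ)))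
  | lam1 t _ _ ih₁ ih₂ =>
    exact fun hΓ hσ => .lam1 t (ih₂ (.cons hΓ (ih₁ hΓ hσ)) (hσ.up (ih₁ hΓ hσ)))
  | app0 _ _ ih₁ ih₂ =>
    intro σ Γ' hΓ hσ
    rw [subst_subst1]
    exact .app0 (ih₁ hΓ hσ) (ih₂ hΓ hσ)
  | app1 _ _ ih₁ ih₂ =>
    intro σ Γ' hΓ hσ
    rw [subst_subst1]
    exact .app1 (ih₁ hΓ hσ) (ih₂ hΓ hσ)
  | conv _ _ hc ih₁ ih₂ =>
    exact fun hΓ hσ => .conv (ih₁ hΓ hσ) (ih₂ hΓ hσ) (hc.subst _)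

theorem LTyped.lsubst_single {Γ n A} (h : LTyped Γ n A) : LSubst (single n) (A :: Γ) Γ := by
  intro x B hx
  cases hx with
  | zero => rw [subst_single_shift]; exact h
  | succ hx => rw [subst_single_shift]; exact .var h.wf hx

theorem LTyped.subst1 {Γ m n A B} (hm : LTyped (A :: Γ) m B) (hn : LTyped Γ n A) :
    LTyped Γ (subst1 n m) (subst1 n B) := by
  rw [subst1_eq, subst1_eq]
  exact hm.subst hn.wf hn.lsubst_single

theorem Has.typed {Γ x A} (h : Has Γ x A) (hΓ : LWf Γ) : ∃ s, LTyped Γ A (.srt s) := by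
  induction h with
  | zero =>
    cases hΓ with
    | cons _ hA => exact ⟨_, hA.shift hA⟩
  | succ _ ih =>
    cases hΓ with
    | cons hΓ hB => exact (ih hΓ).imp fun _ hA => hA.shift hB

theorem LTyped.pi0_inv {Γ t A B C} (h : LTyped Γ (.pi0 t A B) C) :
    ∃ r, LTyped (A :: Γ) B (.srt r) := by
  generalize e : Tm.pi0 t A B = M at h
  induction h using LTyped.domain_induction with
  | pi0 _ _ h => cases e; exact ⟨_, h⟩
  | conv _ _ _ ih _ => exact ih e
  | _ => cases e

theorem LTyped.pi1_inv {Γ t A B C} (h : LTyped Γ (.pi1 t A B) C) :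
    ∃ r, LTyped (A :: Γ) B (.srt r) := by
  generalize e : Tm.pi1 t A B = M at h
  induction h using LTyped.domain_induction with
  | pi1 _ _ h => cases e; exact ⟨_, h⟩
  | conv _ _ _ ih _ => exact ih e
  | _ => cases e

theorem LTyped.lam0_inv {Γ t A m C} (h : LTyped Γ (.lam0 t A m) C) :
    ∃ B s, LTyped Γ A (.srt s) ∧ LTyped (A :: Γ) m B ∧ Conv (.pi0 t A B) C := by
  generalize e : Tm.lam0 t A m = M at h
  induction h using LTyped.domain_induction with
  | lam0 _ hA h => cases e; exact ⟨_, _, hA, h, .refl _⟩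
  | conv _ _ hc ih _ =>
    obtain ⟨B, s, hA, h, hc'⟩ := ih e
    exact ⟨B, s, hA, h, hc'.trans hc⟩
  | _ => cases e

theorem LTyped.lam1_inv {Γ t A m C} (h : LTyped Γ (.lam1 t A m) C) :
    ∃ B s, LTyped Γ A (.srt s) ∧ LTyped (A :: Γ) m B ∧ Conv (.pi1 t A B) C := by
  generalize e : Tm.lam1 t A m = M at h
  induction h using LTyped.domain_induction with
  | lam1 _ hA h => cases e; exact ⟨_, _, hA, h, .refl _⟩
  | conv _ _ hc ih _ =>
    obtain ⟨B, s, hA, h, hc'⟩ := ih e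
    exact ⟨B, s, hA, h, hc'.trans hc⟩
  | _ => cases e

/-- Types of well-typed terms are well-sorted. -/
theorem LTyped.validity {Γ m A} (h : LTyped Γ m A) : ∃ s, LTyped Γ A (.srt s) := by
  induction h using LTyped.domain_induction with
  | srt _ hΓ => exact ⟨_, .srt _ hΓ⟩
  | var hΓ hx => exact hx.typed hΓ
  | pi0 _ h _ _ _ | pi1 _ h _ _ _ => exact ⟨_, .srt _ h.wf⟩
  | lam0 t hA _ _ ih => exact ⟨t, .pi0 t hA ih.choose_spec⟩
  | lam1 t hA _ _ ih => exact ⟨t, .pi1 t hA ih.choose_spec⟩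
  | app0 _ hn ih _ =>
    obtain ⟨_, h⟩ := ih
    obtain ⟨r, hB⟩ := h.pi0_inv
    exact ⟨r, hB.subst1 hn⟩
  | app1 _ hn ih _ =>
    obtain ⟨_, h⟩ := ih
    obtain ⟨r, hB⟩ := h.pi1_inv
    exact ⟨r, hB.subst1 hn⟩
  | conv _ h _ _ _ => exact ⟨_, h⟩

theorem LTyped.pi0_codomain {Γ m n t A B} (hm : LTyped Γ m (.pi0 t A B)) (hn : LTyped Γ n A) :
    ∃ s, LTyped Γ (TLL.subst1 n B) (.srt s) :=
  (LTyped.app0 hm hn).validity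

theorem LTyped.pi1_codomain {Γ m n t A B} (hm : LTyped Γ m (.pi1 t A B)) (hn : LTyped Γ n A) :
    ∃ s, LTyped Γ (TLL.subst1 n B) (.srt s) :=
  (LTyped.app1 hm hn).validity

/-- Logical typing is preserved by program reduction. -/
theorem LTyped.cstep {Γ m A} (h : LTyped Γ m A) : ∀ {n}, CStep m n → LTyped Γ n A := by
  induction h using LTyped.domain_induction with
  | app0 hm hn ihm ihn =>
    intro n' hr
    obtain ⟨s, hs⟩ := hm.pi0_codomain hn
    cases hr with
    | appL hr => exact .app0 (ihm hr) hn
    | appR hr => exact .conv (.app0 hm (ihn hr)) hs (hr.conv_subst1 _).symm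
    | beta0 =>
      obtain ⟨B', _, hA, hb, hc⟩ := hm.lam0_inv
      obtain ⟨hcA, hcB⟩ := hc.pi0_inj
      exact .conv (hb.subst1 (.conv hn hA hcA.symm)) hs (hcB.subst1 _)
    | beta1 =>
      obtain ⟨_, _, _, _, hc⟩ := hm.lam1_inv
      exact absurd hc.symm Conv.not_pi0_pi1
  | app1 hm hn ihm ihn =>
    intro n' hr
    obtain ⟨s, hs⟩ := hm.pi1_codomain hn
    cases hr with
    | appL hr => exact .app1 (ihm hr) hn
    | appR hr => exact .conv (.app1 hm (ihn hr)) hs (hr.conv_subst1 _).symm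
    | beta0 =>
      obtain ⟨_, _, _, _, hc⟩ := hm.lam0_inv
      exact absurd hc Conv.not_pi0_pi1
    | beta1 =>
      obtain ⟨B', _, hA, hb, hc⟩ := hm.lam1_inv
      obtain ⟨hcA, hcB⟩ := hc.pi1_inj
      exact .conv (hb.subst1 (.conv hn hA hcA.symm)) hs (hcB.subst1 _)
  | conv _ hB hc ih _ => exact fun hr => .conv (ih hr) hB hc
  | _ => intro _ hr; cases hr

/-! ### Program typing -/

theorem PWf.lwf {Γ Δ} (h : PWf Γ Δ) : LWf Γ := by
  induction h with
  | nil => exact .nil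
  | cons _ hA ih | consN _ hA ih => exact .cons ih hA

theorem PHas.has {Δ x s A} (h : PHas Δ x s A) : ∀ {Γ}, PWf Γ Δ → Has Γ x A := by
  induction h with
  | zero => intro _ hΓ; cases hΓ; exact .zero
  | succN _ ih =>
    intro _ hΓ
    cases hΓ with
    | consN hΓ _ => exact .succ (ih hΓ)
  | succU _ ih =>
    intro _ hΓ
    cases hΓ with
    | cons hΓ _ => exact .succ (ih hΓ)

theorem Merge.pwf {Δ₁ Δ₂ Δ} (h : Merge Δ₁ Δ₂ Δ) : ∀ {Γ}, PWf Γ Δ₁ → PWf Γ Δ₂ → PWf Γ Δ := by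
  induction h with
  | nil => exact fun h _ => h
  | contra _ ih | left _ ih | right _ ih | skip _ ih =>
    intro _ h₁ h₂
    cases h₁
    cases h₂
    constructor <;> first | exact ih ‹_› ‹_› | assumption

theorem PTyped.pwf {Γ Δ m A} (h : PTyped Γ Δ m A) : PWf Γ Δ := by
  induction h with
  | var h => exact h
  | lam0 _ _ _ ih | lam1 _ _ _ ih => cases ih; assumption
  | app0 _ _ ih | conv _ _ _ ih => exact ih
  | app1 _ _ h ih₁ ih₂ => exact h.pwf ih₁ ih₂

theorem PTyped.ltyped {Γ Δ m A} (h : PTyped Γ Δ m A) : LTyped Γ m A := by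
  induction h with
  | var hΓ hx => exact .var hΓ.lwf (hx.has hΓ)
  | lam0 t _ _ ih => exact .lam0 t ih
  | lam1 t _ _ ih => exact .lam1 t ih
  | app0 _ hn ih => exact .app0 ih hn
  | app1 _ _ _ ih₁ ih₂ => exact .app1 ih₁ ih₂
  | conv _ hB hc ih => exact .conv ih hB hc

/-- `PWeaken ξ Γ Δ Γ' Δ'`: the renaming `ξ` inserts one absent or non-linear entry into
`Γ ; Δ`, which yields `Γ' ; Δ'`. -/
inductive PWeaken : (Nat → Nat) → Ctx → PCtx → Ctx → PCtx → Prop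
  | absent {Γ Δ A s} : LTyped Γ A (.srt s) →
      PWeaken Nat.succ Γ Δ (A :: Γ) ((none : Entry) :: Δ)
  | nonlinear {Γ Δ A} : LTyped Γ A (.srt .U) →
      PWeaken Nat.succ Γ Δ (A :: Γ) (some (.U, A) :: Δ)
  | cons {ξ Γ Δ Γ' Δ' A s} : PWeaken ξ Γ Δ Γ' Δ' →
      PWeaken (upr ξ) (A :: Γ) (some (s, A) :: Δ)
        (rename ξ A :: Γ') (some (s, rename ξ A) :: Δ')
  | consN {ξ Γ Δ Γ' Δ' A} : PWeaken ξ Γ Δ Γ' Δ' →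
      PWeaken (upr ξ) (A :: Γ) ((none : Entry) :: Δ) (rename ξ A :: Γ') ((none : Entry) :: Δ')

theorem PWeaken.has {ξ Γ Δ Γ' Δ'} (h : PWeaken ξ Γ Δ Γ' Δ') :
    ∀ {x A}, Has Γ x A → Has Γ' (ξ x) (rename ξ A) := by
  induction h with
  | absent | nonlinear => exact .succ
  | cons _ ih | consN _ ih =>
    intro x B hx
    cases hx with
    | zero => rw [rename_upr_shift]; exact .zero
    | succ hx => rw [rename_upr_shift]; exact .succ (ih hx)

theorem PWeaken.pwf {ξ Γ Δ Γ' Δ'} (h : PWeaken ξ Γ Δ Γ' Δ') (hΓ : PWf Γ Δ) : PWf Γ' Δ' := by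
  induction h with
  | absent hA => exact .consN hΓ hA
  | nonlinear hA => exact .cons hΓ hA
  | cons h ih =>
    cases hΓ with
    | cons hΓ hA => exact .cons (ih hΓ) (hA.rename (ih hΓ).lwf h.has)
  | consN h ih =>
    cases hΓ with
    | consN hΓ hA => exact .consN (ih hΓ) (hA.rename (ih hΓ).lwf h.has)

theorem PWeaken.restr {ξ Γ Δ Γ' Δ'} (h : PWeaken ξ Γ Δ Γ' Δ') {t} (ht : Restr Δ t) :
    Restr Δ' t := by
  induction h generalizing t with
  | absent => exact .skip ht
  | nonlinear =>
    cases t with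
    | U => exact .u ht
    | L => exact .l ht
  | cons _ ih =>
    cases ht with
    | u ht => exact .u (ih ht)
    | l ht => exact .l (ih ht)
  | consN _ ih =>
    cases ht with
    | skip ht => exact .skip (ih ht)

theorem PWeaken.phas {ξ Γ Δ Γ' Δ'} (h : PWeaken ξ Γ Δ Γ' Δ') {x s A} (hx : PHas Δ x s A) :
    PHas Δ' (ξ x) s (rename ξ A) := by
  induction h generalizing x s A with
  | absent => exact .succN hx
  | nonlinear => exact .succU hx
  | cons h ih =>
    cases hx with
    | zero ht => rw [rename_upr_shift]; exact .zero (h.restr ht)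
    | succU hx => rw [rename_upr_shift]; exact .succU (ih hx)
  | consN _ ih =>
    cases hx with
    | succN hx => rw [rename_upr_shift]; exact .succN (ih hx)

theorem PWeaken.merge {ξ Γ Δ Γ' Δ'} (h : PWeaken ξ Γ Δ Γ' Δ') {Δ₁ Δ₂} (hm : Merge Δ₁ Δ₂ Δ) :
    ∃ Δ₁' Δ₂', PWeaken ξ Γ Δ₁ Γ' Δ₁' ∧ PWeaken ξ Γ Δ₂ Γ' Δ₂' ∧ Merge Δ₁' Δ₂' Δ' := by
  induction h generalizing Δ₁ Δ₂ with
  | absent hA => exact ⟨_, _, .absent hA, .absent hA, .skip hm⟩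
  | nonlinear hA => exact ⟨_, _, .nonlinear hA, .nonlinear hA, .contra hm⟩
  | cons _ ih =>
    cases hm with
    | contra hm =>
      obtain ⟨_, _, h₁, h₂, hm'⟩ := ih hm
      exact ⟨_, _, .cons h₁, .cons h₂, .contra hm'⟩
    | left hm =>
      obtain ⟨_, _, h₁, h₂, hm'⟩ := ih hm
      exact ⟨_, _, .cons h₁, .consN h₂, .left hm'⟩
    | right hm =>
      obtain ⟨_, _, h₁, h₂, hm'⟩ := ih hm
      exact ⟨_, _, .consN h₁, .cons h₂, .right hm'⟩
  | consN _ ih =>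
    cases hm with
    | skip hm =>
      obtain ⟨_, _, h₁, h₂, hm'⟩ := ih hm
      exact ⟨_, _, .consN h₁, .consN h₂, .skip hm'⟩

theorem PTyped.weaken {Γ Δ m A} (h : PTyped Γ Δ m A) :
    ∀ {ξ Γ' Δ'}, PWeaken ξ Γ Δ Γ' Δ' → PTyped Γ' Δ' (rename ξ m) (rename ξ A) := by
  induction h with
  | var hΓ hx => exact fun hξ => .var (hξ.pwf hΓ) (hξ.phas hx)
  | lam0 t _ ht ih => exact fun hξ => .lam0 t (ih hξ.consN) (hξ.restr ht)
  | lam1 t _ ht ih => exact fun hξ => .lam1 t (ih hξ.cons) (hξ.restr ht)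
  | app0 hm hn ih =>
    intro ξ Γ' Δ' hξ
    rw [rename_subst1]
    exact .app0 (ih hξ) (hn.rename (hξ.pwf hm.pwf).lwf hξ.has)
  | app1 _ _ hm ih₁ ih₂ =>
    intro ξ Γ' Δ' hξ
    obtain ⟨_, _, h₁, h₂, hm'⟩ := hξ.merge hm
    rw [rename_subst1]
    exact .app1 (ih₁ h₁) (ih₂ h₂) hm'
  | conv h hB hc ih =>
    exact fun hξ => .conv (ih hξ) (hB.rename (hξ.pwf h.pwf).lwf hξ.has) (hc.rename _)

/-- `PSubst σ Γ Δ Γ' Δ'`: the substitution `σ` replaces the bottommost entry of `Γ ; Δ` by a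
closed term, which yields `Γ' ; Δ'`. The term has to be a program only if the entry is
present in `Δ`. -/
inductive PSubst : (Nat → Tm) → Ctx → PCtx → Ctx → PCtx → Prop
  | absent {v A} : LTyped [] v A → PSubst (single v) [A] [none] [] []
  | present {v A s} : PTyped [] [] v A → PSubst (single v) [A] [some (s, A)] [] []
  | cons {σ Γ Δ Γ' Δ' A s} : PSubst σ Γ Δ Γ' Δ' →
      PSubst (up σ) (A :: Γ) (some (s, A) :: Δ) (subst σ A :: Γ') (some (s, subst σ A) :: Δ')
  | consN {σ Γ Δ Γ' Δ' A} : PSubst σ Γ Δ Γ' Δ' →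
      PSubst (up σ) (A :: Γ) ((none : Entry) :: Δ) (subst σ A :: Γ') ((none : Entry) :: Δ')

theorem PSubst.wf {σ Γ Δ Γ' Δ'} (h : PSubst σ Γ Δ Γ' Δ') (hΓ : PWf Γ Δ) :
    PWf Γ' Δ' ∧ LSubst σ Γ Γ' := by
  induction h with
  | absent hv => exact ⟨.nil, hv.lsubst_single⟩
  | present hv => exact ⟨.nil, hv.ltyped.lsubst_single⟩
  | cons _ ih =>
    cases hΓ with
    | cons hΓ hA =>
      obtain ⟨hΓ', hσ⟩ := ih hΓ
      have hA' := hA.subst hΓ'.lwf hσ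
      exact ⟨.cons hΓ' hA', hσ.up hA'⟩
  | consN _ ih =>
    cases hΓ with
    | consN hΓ hA =>
      obtain ⟨hΓ', hσ⟩ := ih hΓ
      have hA' := hA.subst hΓ'.lwf hσ
      exact ⟨.consN hΓ' hA', hσ.up hA'⟩

theorem PSubst.ltyped {σ Γ Δ Γ' Δ'} (h : PSubst σ Γ Δ Γ' Δ') (hΓ : PWf Γ Δ) {m A}
    (hm : LTyped Γ m A) : LTyped Γ' (subst σ m) (subst σ A) :=
  hm.subst (h.wf hΓ).1.lwf (h.wf hΓ).2

theorem PSubst.restr {σ Γ Δ Γ' Δ'} (h : PSubst σ Γ Δ Γ' Δ') {t} (ht : Restr Δ t) :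
    Restr Δ' t := by
  induction h generalizing t with
  | absent | present => exact .nil
  | cons _ ih =>
    cases ht with
    | u ht => exact .u (ih ht)
    | l ht => exact .l (ih ht)
  | consN _ ih =>
    cases ht with
    | skip ht => exact .skip (ih ht)

theorem PSubst.phas {σ Γ Δ Γ' Δ'} (h : PSubst σ Γ Δ Γ' Δ') (hΓ : PWf Γ Δ) {x s A}
    (hx : PHas Δ x s A) : PTyped Γ' Δ' (σ x) (subst σ A) := by
  induction h generalizing x s A with
  | absent =>
    cases hx with
    | succN hx => cases hx
  | present hv =>
    cases hx with
    | zero => rw [subst_single_shift]; exact hv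
    | succU hx => cases hx
  | cons h ih =>
    have hΓ' := (h.cons.wf hΓ).1
    cases hΓ with
    | cons hΓ hA =>
      rcases hx with ht | _ | hx <;> rw [subst_up_shift]
      · exact .var hΓ' (.zero (h.restr ht))
      · exact (ih hΓ hx).weaken (.nonlinear (h.ltyped hΓ hA))
  | consN h ih =>
    cases hΓ with
    | consN hΓ hA =>
      cases hx with
      | succN hx =>
        rw [subst_up_shift]
        exact (ih hΓ hx).weaken (.absent (h.ltyped hΓ hA))

theorem PSubst.merge {σ Γ Δ Γ' Δ'} (h : PSubst σ Γ Δ Γ' Δ') {Δ₁ Δ₂} (hm : Merge Δ₁ Δ₂ Δ) :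
    ∃ Δ₁' Δ₂', PSubst σ Γ Δ₁ Γ' Δ₁' ∧ PSubst σ Γ Δ₂ Γ' Δ₂' ∧ Merge Δ₁' Δ₂' Δ' := by
  induction h generalizing Δ₁ Δ₂ with
  | absent hv =>
    cases hm with
    | skip hm => cases hm; exact ⟨_, _, .absent hv, .absent hv, .nil⟩
  | present hv =>
    cases hm with
    | contra hm => cases hm; exact ⟨_, _, .present hv, .present hv, .nil⟩
    | left hm => cases hm; exact ⟨_, _, .present hv, .absent hv.ltyped, .nil⟩
    | right hm => cases hm; exact ⟨_, _, .absent hv.ltyped, .present hv, .nil⟩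
  | cons _ ih =>
    cases hm with
    | contra hm =>
      obtain ⟨_, _, h₁, h₂, hm'⟩ := ih hm
      exact ⟨_, _, .cons h₁, .cons h₂, .contra hm'⟩
    | left hm =>
      obtain ⟨_, _, h₁, h₂, hm'⟩ := ih hm
      exact ⟨_, _, .cons h₁, .consN h₂, .left hm'⟩
    | right hm =>
      obtain ⟨_, _, h₁, h₂, hm'⟩ := ih hm
      exact ⟨_, _, .consN h₁, .cons h₂, .right hm'⟩
  | consN _ ih =>
    cases hm with
    | skip hm =>
      obtain ⟨_, _, h₁, h₂, hm'⟩ := ih hm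
      exact ⟨_, _, .consN h₁, .consN h₂, .skip hm'⟩

theorem PTyped.subst {Γ Δ m A} (h : PTyped Γ Δ m A) :
    ∀ {σ Γ' Δ'}, PSubst σ Γ Δ Γ' Δ' → PTyped Γ' Δ' (subst σ m) (subst σ A) := by
  induction h with
  | var hΓ hx => exact fun hσ => hσ.phas hΓ hx
  | lam0 t _ ht ih => exact fun hσ => .lam0 t (ih hσ.consN) (hσ.restr ht)
  | lam1 t _ ht ih => exact fun hσ => .lam1 t (ih hσ.cons) (hσ.restr ht)
  | app0 hm hn ih =>
    intro σ Γ' Δ' hσ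
    rw [subst_subst1]
    exact .app0 (ih hσ) (hσ.ltyped hm.pwf hn)
  | app1 _ _ hm ih₁ ih₂ =>
    intro σ Γ' Δ' hσ
    obtain ⟨_, _, h₁, h₂, hm'⟩ := hσ.merge hm
    rw [subst_subst1]
    exact .app1 (ih₁ h₁) (ih₂ h₂) hm'
  | conv h hB hc ih => exact fun hσ => .conv (ih hσ) (hσ.ltyped h.pwf hB) (hc.subst _)

theorem PTyped.lam0_inv {Γ Δ t A m C} (h : PTyped Γ Δ (.lam0 t A m) C) :
    ∃ B, PTyped (A :: Γ) ((none : Entry) :: Δ) m B ∧ Conv (.pi0 t A B) C := by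
  generalize e : Tm.lam0 t A m = M at h
  induction h with
  | lam0 _ h => cases e; exact ⟨_, h, .refl _⟩
  | conv _ _ hc ih =>
    obtain ⟨B, h, hc'⟩ := ih e
    exact ⟨B, h, hc'.trans hc⟩
  | _ => cases e

theorem PTyped.lam1_inv {Γ Δ t A m C} (h : PTyped Γ Δ (.lam1 t A m) C) :
    ∃ B s, PTyped (A :: Γ) (some (s, A) :: Δ) m B ∧ Conv (.pi1 t A B) C := by
  generalize e : Tm.lam1 t A m = M at h
  induction h with
  | lam1 _ h => cases e; exact ⟨_, _, h, .refl _⟩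
  | conv _ _ hc ih =>
    obtain ⟨B, s, h, hc'⟩ := ih e
    exact ⟨B, s, h, hc'.trans hc⟩
  | _ => cases e

/-- Program subject reduction. -/
theorem program_subject_reduction {m n A : Tm}
    (h : PTyped [] [] m A) (hr : CStep m n) :
    PTyped [] [] n A := by
  generalize hΓ : ([] : Ctx) = Γ at h
  generalize hΔ : ([] : PCtx) = Δ at h
  induction h generalizing n with
  | app0 hm hn ihm =>
    subst hΓ hΔ
    obtain ⟨s, hs⟩ := hm.ltyped.pi0_codomain hn
    cases hr with
    | appL hr => exact .app0 (ihm hr rfl rfl) hn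
    | appR hr => exact .conv (.app0 hm (hn.cstep hr)) hs (hr.conv_subst1 _).symm
    | beta0 =>
      obtain ⟨B', hb, hc⟩ := hm.lam0_inv
      obtain ⟨hcA, hcB⟩ := hc.pi0_inj
      cases hb.pwf with
      | consN _ hA =>
        have hb' := hb.subst (.absent (.conv hn hA hcA.symm))
        rw [← subst1_eq, ← subst1_eq] at hb'
        exact .conv hb' hs (hcB.subst1 _)
    | beta1 =>
      obtain ⟨_, _, _, hc⟩ := hm.lam1_inv
      exact absurd hc.symm Conv.not_pi0_pi1
  | app1 hm hn hmerge ihm ihn =>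
    subst hΓ hΔ
    cases hmerge
    obtain ⟨s, hs⟩ := hm.ltyped.pi1_codomain hn.ltyped
    cases hr with
    | appL hr => exact .app1 (ihm hr rfl rfl) hn .nil
    | appR hr => exact .conv (.app1 hm (ihn hr rfl rfl) .nil) hs (hr.conv_subst1 _).symm
    | beta0 =>
      obtain ⟨_, _, hc⟩ := hm.lam0_inv
      exact absurd hc Conv.not_pi0_pi1
    | beta1 =>
      obtain ⟨B', _, hb, hc⟩ := hm.lam1_inv
      obtain ⟨hcA, hcB⟩ := hc.pi1_inj
      cases hb.pwf with
      | cons _ hA =>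
        have hb' := hb.subst (.present (.conv hn hA hcA.symm))
        rw [← subst1_eq, ← subst1_eq] at hb'
        exact .conv hb' hs (hcB.subst1 _)
  | conv _ hB hc ih =>
    subst hΓ hΔ
    exact .conv (ih hr rfl rfl) hB hc
  | _ => cases hr
end TLL
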